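/- Let f : ℝⁿ → ℝ be Lipschitz continuous on a neighborhood of a point x̂ ∈ ℝⁿ, let v ∈ ℝⁿ, and let (x_k) ⊆ ℝⁿ, (v_k) ⊆ ℝⁿ and (t_k) ⊆ ℝ be sequences with x_k → x̂, v_k → v, t_k > 0 and t_k → 0. If liminf_{k→∞} (f(x_k + t_k·v_k) − f(x_k))/t_k ≥ 0, then the Clarke generalized directional derivative of f at x̂ in direction v is nonnegative: f°(x̂; v) ≥ 0. -/

import Mathlib

open Filter

theorem stmt_14 {n : ℕ} (f : (Fin n → ℝ) → ℝ) (xhat v : Fin n → ℝ)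
    (hf : ∃ U ∈ nhds xhat, ∃ L : NNReal, LipschitzOnWith L f U)
    (x : ℕ → (Fin n → ℝ)) (w : ℕ → (Fin n → ℝ)) (t : ℕ → ℝ)
    (hx : Tendsto x atTop (nhds xhat)) (hw : Tendsto w atTop (nhds v))
    (ht : ∀ k, 0 < t k) (ht0 : Tendsto t atTop (nhds 0))
    (hliminf : 0 ≤ Filter.liminf (fun k => (f (x k + t k • w k) - f (x k)) / t k) atTop) :
    0 ≤ Filter.limsup (fun p : (Fin n → ℝ) × ℝ => (f (p.1 + p.2 • v) - f p.1) / p.2)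
      ((nhds xhat) ×ˢ (nhdsWithin (0 : ℝ) (Set.Ioi 0))) := by
  obtain ⟨U, hU, L, hL⟩ := hf
  have hxw : Tendsto (fun k => x k + t k • w k) atTop (nhds xhat) := by
    simpa using hx.add (ht0.smul hw)
  have hxv : Tendsto (fun k => x k + t k • v) atTop (nhds xhat) := by
    simpa using hx.add (ht0.smul_const v)
  have hp : Tendsto (fun k => (x k, t k)) atTop
      ((nhds xhat) ×ˢ (nhdsWithin (0 : ℝ) (Set.Ioi 0))) :=
    hx.prodMk (tendsto_nhdsWithin_iff.2 ⟨ht0, Eventually.of_forall ht⟩)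
  have hbdd : IsBoundedUnder (· ≥ ·) atTop
      (fun k => (f (x k + t k • w k) - f (x k)) / t k) := by
    refine ⟨-(L * (‖v‖ + 1)), ?_⟩
    rw [eventually_map]
    have hn : ∀ᶠ k in atTop, ‖w k‖ < ‖v‖ + 1 :=
      hw.norm.eventually (gt_mem_nhds (by linarith))
    filter_upwards [hx.eventually hU, hxw.eventually hU, hn] with k h1 h2 h3
    have h := hL.dist_le_mul _ h2 _ h1
    rw [Real.dist_eq, dist_eq_norm, add_sub_cancel_left, norm_smul, Real.norm_eq_abs,
      abs_of_pos (ht k)] at h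
    have h4 := neg_abs_le (f (x k + t k • w k) - f (x k))
    show -(L * (‖v‖ + 1)) ≤ _
    rw [le_div_iff₀ (ht k)]
    have h5 : (L : ℝ) * (t k * ‖w k‖) ≤ L * (t k * (‖v‖ + 1)) := by
      have := (ht k).le
      gcongr
    linarith
  rw [limsup_eq]
  apply Real.sInf_nonneg
  intro a ha
  by_contra! hneg
  have ha' := hp.eventually ha
  have hd : Tendsto (fun k => (L : ℝ) * ‖w k - v‖) atTop (nhds 0) := by
    simpa using ((hw.sub_const v).norm).const_mul (L : ℝ)
  have hsmall : ∀ᶠ k in atTop, (L : ℝ) * ‖w k - v‖ < -a / 2 :=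
    hd.eventually (gt_mem_nhds (by linarith))
  have hle : ∀ᶠ k in atTop, (f (x k + t k • w k) - f (x k)) / t k ≤ a / 2 := by
    filter_upwards [ha', hsmall, hxw.eventually hU, hxv.eventually hU] with k h1 h2 h3 h4
    have h := hL.dist_le_mul _ h3 _ h4
    rw [Real.dist_eq, dist_eq_norm, add_sub_add_left_eq_sub, ← smul_sub, norm_smul,
      Real.norm_eq_abs, abs_of_pos (ht k)] at h
    have h5 := le_abs_self (f (x k + t k • w k) - f (x k + t k • v))
    rw [div_le_iff₀ (ht k)] at h1 ⊢
    have h6 := mul_lt_mul_of_pos_left h2 (ht k)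
    linarith
  have := liminf_le_of_frequently_le hle.frequently hbdd
  linarith
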